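/- For any nonzero positive bounded operator x on a Hilbert space, (1/2)·‖1 − x/‖x‖‖ ≤ Δ(x) ≤ ‖1 − x/‖x‖‖. -/

import Mathlib

variable {H : Type*} [NormedAddCommGroup H] [InnerProductSpace ℂ H] [CompleteSpace H]

/-- Michelson contrast / centrality measure for operators. -/
noncomputable def Delta (x : H →L[ℂ] H) : ℝ :=
  ⨅ A : {A : ℝ // 0 < A}, ‖(1 : H →L[ℂ] H) - (A.1)⁻¹ • x‖

theorem delta_bounds (x : H →L[ℂ] H) (hx : x.IsPositive) (hne : x ≠ 0) :
    (1 / 2) * ‖(1 : H →L[ℂ] H) - ‖x‖⁻¹ • x‖ ≤ Delta x ∧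
      Delta x ≤ ‖(1 : H →L[ℂ] H) - ‖x‖⁻¹ • x‖ := by
  have hB : 0 < ‖x‖ := norm_pos_iff.mpr hne
  have hnt : Nontrivial H := by
    by_contra h
    rw [not_nontrivial_iff_subsingleton] at h
    exact hne (Subsingleton.elim _ _)
  constructor
  · unfold Delta
    haveI : Nonempty {A : ℝ // 0 < A} := ⟨⟨1, one_pos⟩⟩
    refine le_ciInf fun A => ?_
    obtain ⟨A, hA⟩ := A
    have h1 : ‖(1 : H →L[ℂ] H)‖ = 1 := norm_one
    have e : (1 : H →L[ℂ] H) - ‖x‖⁻¹ • x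
        = ((1 : H →L[ℂ] H) - A⁻¹ • x) + (A⁻¹ - ‖x‖⁻¹) • x := by
      rw [sub_smul]; abel
    have h2 : ‖(A⁻¹ - ‖x‖⁻¹) • x‖ = |1 - A⁻¹ * ‖x‖| := by
      rw [norm_smul, Real.norm_eq_abs, abs_sub_comm]
      nth_rewrite 2 [← abs_of_pos hB]
      rw [← abs_mul, sub_mul, inv_mul_cancel₀ hB.ne']
    have h3 : |1 - A⁻¹ * ‖x‖| ≤ ‖(1 : H →L[ℂ] H) - A⁻¹ • x‖ := by
      have h4 := abs_norm_sub_norm_le (1 : H →L[ℂ] H) (A⁻¹ • x)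
      rwa [h1, norm_smul, Real.norm_eq_abs, abs_of_pos (inv_pos.mpr hA)] at h4
    have h5 := norm_add_le ((1 : H →L[ℂ] H) - A⁻¹ • x) ((A⁻¹ - ‖x‖⁻¹) • x)
    rw [← e, h2] at h5
    change _ ≤ ‖(1 : H →L[ℂ] H) - A⁻¹ • x‖
    linarith
  · exact ciInf_le (f := fun A : {A : ℝ // 0 < A} => ‖(1 : H →L[ℂ] H) - (A.1)⁻¹ • x‖)
      ⟨0, by rintro _ ⟨A, rfl⟩; exact norm_nonneg _⟩ ⟨‖x‖, hB⟩
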